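/- For every integer ℓ ≥ 1 there exist positive real constants c1 and c2 (depending on ℓ) such that for every sufficiently large positive integer n, π(n) + π(⌊n/2⌋) + c1·n^{9ℓ/(18ℓ−2)}/(log n)^{9ℓ/(9ℓ−1)} ≤ F_{36ℓ,3}(n) ≤ π(n) + π(⌊n/2⌋) + c2·n^{5/6}. -/

import Mathlib

open Finset Filter

/-- `Fkd k d n` is the maximum cardinality of a set `A ⊆ {1,…,n}` such that there are no
`a_1 < a_2 < ⋯ < a_k` in `A` and positive integer `x` with `a_1 ⋯ a_k = x ^ d`. -/
noncomputable def Fkd (k d n : ℕ) : ℕ :=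
  sSup {m : ℕ | ∃ A : Finset ℕ, A ⊆ Finset.Icc 1 n ∧ A.card = m ∧
    ∀ (a : Fin k → ℕ) (x : ℕ), (∀ i, a i ∈ A) → StrictMono a → 0 < x →
      (∏ i, a i) ≠ x ^ d}


def CubeFree (k : ℕ) (A : Finset ℕ) : Prop :=
  ∀ S ⊆ A, S.card = k → ∀ x : ℕ, 0 < x → ∏ a ∈ S, a ≠ x ^ 3

lemma cubeFree_iff (k : ℕ) (A : Finset ℕ) :
    (∀ (a : Fin k → ℕ) (x : ℕ), (∀ i, a i ∈ A) → StrictMono a → 0 < x →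
      (∏ i, a i) ≠ x ^ 3) ↔ CubeFree k A := by
  constructor
  · intro h S hS hc x hx
    have := h (S.orderEmbOfFin hc) x (fun i => hS (S.orderEmbOfFin_mem hc i))
      (S.orderEmbOfFin hc).strictMono hx
    rw [← Finset.prod_image (s := Finset.univ) (g := S.orderEmbOfFin hc) (f := fun a => a)
      (by intro a _ b _ hab; exact (S.orderEmbOfFin hc).injective hab),
      Finset.image_orderEmbOfFin_univ] at this
    exact this
  · intro h a x ha hm hx
    have := h (Finset.univ.image a) (by
      intro y hy
      obtain ⟨i, _, rfl⟩ := Finset.mem_image.1 hy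
      exact ha i) (by rw [Finset.card_image_of_injective _ hm.injective]; simp) x hx
    rwa [Finset.prod_image (by intro a _ b _ hab; exact hm.injective hab)] at this

lemma Fkd_bdd (k n : ℕ) : BddAbove {m : ℕ | ∃ A : Finset ℕ, A ⊆ Finset.Icc 1 n ∧ A.card = m ∧
    ∀ (a : Fin k → ℕ) (x : ℕ), (∀ i, a i ∈ A) → StrictMono a → 0 < x →
      (∏ i, a i) ≠ x ^ 3} := by
  refine ⟨n, ?_⟩
  rintro m ⟨A, hA, rfl, -⟩
  simpa using Finset.card_le_card hA

lemma le_Fkd (k n : ℕ) (A : Finset ℕ) (hA : A ⊆ Finset.Icc 1 n) (h : CubeFree k A) :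
    A.card ≤ Fkd k 3 n :=
  le_csSup (Fkd_bdd k n) ⟨A, hA, rfl, (cubeFree_iff k A).2 h⟩

lemma Fkd_attained (k n : ℕ) (hk : 0 < k) :
    ∃ A : Finset ℕ, A ⊆ Finset.Icc 1 n ∧ CubeFree k A ∧ Fkd k 3 n = A.card := by
  have hne : {m : ℕ | ∃ A : Finset ℕ, A ⊆ Finset.Icc 1 n ∧ A.card = m ∧
    ∀ (a : Fin k → ℕ) (x : ℕ), (∀ i, a i ∈ A) → StrictMono a → 0 < x →
      (∏ i, a i) ≠ x ^ 3}.Nonempty := by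
    refine ⟨0, ∅, by simp, by simp, ?_⟩
    intro a x ha
    exact absurd (ha ⟨0, hk⟩) (by simp)
  obtain ⟨A, hA, hc, h⟩ := Nat.sSup_mem hne (Fkd_bdd k n)
  exact ⟨A, hA, (cubeFree_iff k A).1 h, hc.symm⟩

lemma reduce_nine (j : ℕ) : ∀ A : Finset ℕ, CubeFree (9 * (j + 1)) A →
    ∃ B ⊆ A, CubeFree 9 B ∧ A.card ≤ B.card + 9 * j := by
  induction j with
  | zero => intro A hA; exact ⟨A, subset_rfl, by simpa using hA, by simp⟩
  | succ j ih =>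
    intro A hA
    by_cases h : CubeFree 9 A
    · exact ⟨A, subset_rfl, h, by simp⟩
    · unfold CubeFree at h
      push Not at h
      obtain ⟨S, hS, hc, x, hx, hp⟩ := h
      obtain ⟨B, hB, hB9, hcard⟩ := ih (A \ S) (by
        intro T hT hTc y hy hTy
        have hdis : Disjoint S T := by
          rw [Finset.disjoint_left]
          intro a ha haT
          exact (Finset.mem_sdiff.1 (hT haT)).2 ha
        refine hA (S ∪ T) (Finset.union_subset hS (hT.trans Finset.sdiff_subset)) ?_ (x * y)
          (Nat.mul_pos hx hy) ?_
        · rw [Finset.card_union_of_disjoint hdis]; omega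
        · rw [Finset.prod_union hdis, hp, hTy]; ring)
      refine ⟨B, hB.trans Finset.sdiff_subset, hB9, ?_⟩
      rw [Finset.card_sdiff_of_subset hS] at hcard
      omega

lemma exists_divisor (a : ℕ) (ha : 1 ≤ a) :
    ∃ v, v ∣ a ∧ a ≤ v * v ∧ (v.Prime ∨ v ^ 3 ≤ a ^ 2) := by
  classical
  have hex : ∃ v, v ∣ a ∧ a ≤ v * v := ⟨a, dvd_rfl, by nlinarith⟩
  set v := Nat.find hex with hv
  obtain ⟨h1, h2⟩ := Nat.find_spec hex
  rw [← hv] at h1 h2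
  refine ⟨v, h1, h2, ?_⟩
  by_cases hp : v.Prime
  · exact Or.inl hp
  right
  have hmin : ∀ w, w ∣ a → w < v → w * w < a := by
    intro w hw hlt
    by_contra hcon
    exact Nat.find_min hex hlt ⟨hw, not_lt.1 hcon⟩
  have hv0 : v ≠ 0 := by rintro h; rw [h] at h2; omega
  by_cases hv1 : v = 1
  · rw [hv1]; nlinarith
  obtain ⟨b, hbv, hb2, hblt⟩ := Nat.exists_dvd_of_not_prime2 (by omega) hp
  obtain ⟨c, hc⟩ := hbv
  -- key: for a proper factorization v = w * z, z < v, we get v ≤ a / z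
  have key : ∀ w z, v = w * z → 2 ≤ w → 2 ≤ z → v * z ≤ a := by
    intro w z hwz hw hz
    have hzv : z < v := by rw [hwz]; nlinarith
    have hza : z ∣ a := (Dvd.intro_left w hwz.symm).trans h1
    have hlt := hmin z hza hzv
    obtain ⟨e, he⟩ := hza
    have : v ≤ e := by
      by_contra hcon
      have := hmin e ⟨z, by rw [he]; ring⟩ (not_le.1 hcon)
      have h3 : z < e := by nlinarith
      have h4 : e < z := by nlinarith
      omega
    rw [he, mul_comm]
    exact Nat.mul_le_mul_left z this
  have hc2 : 2 ≤ c := by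
    rcases c with _ | _ | c
    · omega
    · omega
    · omega
  have k1 := key b c hc hb2 hc2
  have k2 := key c b (by rw [hc]; ring) hc2 hb2
  calc v ^ 3 = (v * c) * (v * b) := by rw [pow_succ, pow_two]; nth_rewrite 3 [hc]; ring
    _ ≤ a * a := Nat.mul_le_mul k1 k2
    _ = a ^ 2 := by ring

noncomputable def cb (u : ℕ) : ℝ := (u : ℝ) ^ ((1 : ℝ) / 3)

lemma cb_cube (u : ℕ) : cb u ^ 3 = u := by
  unfold cb
  rw [← Real.rpow_natCast, ← Real.rpow_mul (by positivity)]
  norm_num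

lemma cb_nonneg (u : ℕ) : 0 ≤ cb u := by unfold cb; positivity

lemma cb_pos (u : ℕ) (hu : 1 ≤ u) : 0 < cb u := by
  unfold cb
  have : (0 : ℝ) < u := by exact_mod_cast hu
  positivity

lemma cb_mono {u v : ℕ} (h : u ≤ v) : cb u ≤ cb v := by
  unfold cb
  have : (u : ℝ) ≤ v := by exact_mod_cast h
  gcongr

/-- the basic difference estimate -/
lemma cb_diff (m : ℕ) : 1 / (3 * cb (m + 1) ^ 2) ≤ cb (m + 1) - cb m := by
  have h1 := cb_cube (m + 1)
  have h0 := cb_cube m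
  have hp := cb_pos (m + 1) (by omega)
  have hn := cb_nonneg m
  have hm := cb_mono (Nat.le_succ m)
  simp only [Nat.succ_eq_add_one] at hm
  push_cast at h1
  rw [div_le_iff₀ (by positivity)]
  have : (cb (m + 1) - cb m) * (cb (m + 1) ^ 2 + cb (m + 1) * cb m + cb m ^ 2) = 1 := by
    linear_combination h1 - h0
  have h2 : cb (m + 1) ^ 2 + cb (m + 1) * cb m + cb m ^ 2 ≤ 3 * cb (m + 1) ^ 2 := by nlinarith
  calc (1 : ℝ) = _ := this.symm
    _ ≤ _ := mul_le_mul_of_nonneg_left h2 (by linarith)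

lemma sum_inv_sq (m : ℕ) : ∑ u ∈ Icc 1 m, 1 / cb u ^ 2 ≤ 3 * cb m := by
  induction m with
  | zero => simpa using cb_nonneg 0
  | succ m ih =>
    rw [Finset.sum_Icc_succ_top (by omega)]
    have := cb_diff m
    have h2 : 1 / (3 * cb (m + 1) ^ 2) = (1 / 3) * (1 / cb (m + 1) ^ 2) := by
      have hp := cb_pos (m + 1) (by omega)
      field_simp
    rw [h2] at this
    linarith

lemma sum_t (x : ℝ) (hx : 0 < x) (m : ℕ) :
    ∑ v ∈ Icc 1 m, x ^ 6 / (x + cb v) ^ 4 ≤ 3 * x ^ 6 * (1 / x - 1 / (x + cb m)) := by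
  induction m with
  | zero =>
    have : cb 0 = 0 := by unfold cb; norm_num
    simp [this]
  | succ m ih =>
    rw [Finset.sum_Icc_succ_top (by omega)]
    have hd := cb_diff m
    have hp := cb_pos (m + 1) (by omega)
    have hn := cb_nonneg m
    have hm := cb_mono (Nat.le_succ m)
    simp only [Nat.succ_eq_add_one] at hm
    set a := cb (m + 1)
    set b := cb m
    have key : 1 / (x + a) ^ 4 ≤ 3 * (1 / (x + b) - 1 / (x + a)) := by
      have e : 1 / (x + b) - 1 / (x + a) = (a - b) / ((x + b) * (x + a)) := by
        field_simp; ring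
      rw [e]
      calc 1 / (x + a) ^ 4 = 3 * ((1 / (3 * (x + a) ^ 2)) / ((x + a) * (x + a))) := by
            field_simp
        _ ≤ 3 * ((1 / (3 * a ^ 2)) / ((x + b) * (x + a))) := by
            gcongr
            linarith
        _ ≤ _ := by gcongr
    have : x ^ 6 / (x + a) ^ 4 ≤ 3 * x ^ 6 * (1 / (x + b) - 1 / (x + a)) := by
      calc x ^ 6 / (x + a) ^ 4 = x ^ 6 * (1 / (x + a) ^ 4) := by ring
        _ ≤ x ^ 6 * (3 * (1 / (x + b) - 1 / (x + a))) := by gcongr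
        _ = _ := by ring
    linarith

lemma deg_ineq (d : ℕ) (t : ℝ) (ht : 0 < t) :
    (d : ℝ) ≤ (min d 2 : ℕ) + t + 6 * ((d.choose 3 : ℕ) * (1 / t ^ 2)) := by
  by_cases hd : d ≤ 2
  · rw [min_eq_left hd]
    have : 0 ≤ 6 * (((d.choose 3 : ℕ) : ℝ) * (1 / t ^ 2)) := by positivity
    linarith
  · obtain ⟨s, rfl⟩ : ∃ s, d = s + 2 := ⟨d - 2, by omega⟩
    rw [min_eq_right (by omega)]
    have h6 : 6 * (s + 2).choose 3 = (s + 2) * (s + 1) * s := by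
      have := Nat.descFactorial_eq_factorial_mul_choose (s + 2) 3
      simp [Nat.descFactorial, Nat.factorial] at this
      rw [← this]; ring
    have h6' : 6 * (((s + 2).choose 3 : ℕ) : ℝ) = (s + 2) * (s + 1) * s := by exact_mod_cast h6
    have hs : (0 : ℝ) ≤ s := by positivity
    have h7 : (s : ℝ) ^ 3 / t ^ 2 ≤ 6 * ((((s + 2).choose 3 : ℕ) : ℝ) * (1 / t ^ 2)) := by
      rw [← mul_assoc, h6', mul_one_div]
      gcongr
      nlinarith
    have h8 : (s : ℝ) ≤ t + s ^ 3 / t ^ 2 := by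
      by_cases h : (s : ℝ) ≤ t
      · have : 0 ≤ (s : ℝ) ^ 3 / t ^ 2 := by positivity
        linarith
      · push Not at h
        have : (s : ℝ) ≤ s ^ 3 / t ^ 2 := by
          rw [le_div_iff₀ (by positivity)]
          have : t ^ 2 ≤ (s : ℝ) ^ 2 := by gcongr
          nlinarith
        linarith
    push_cast
    linarith

lemma sum_triples (s : ℕ) (g : ℕ → ℝ) (hg : ∀ u, 0 ≤ g u) :
    ∑ T ∈ powersetCard 3 (Icc 1 s), g (T.sup id) ≤ ∑ u ∈ Icc 1 s, (u : ℝ) ^ 2 * g u := by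
  have hsup : ∀ T ∈ powersetCard 3 (Icc 1 s), T.sup id ∈ T := by
    intro T hT
    rw [mem_powersetCard] at hT
    have hne : T.Nonempty := by rw [← card_pos]; omega
    obtain ⟨y, hy, h⟩ := exists_mem_eq_sup T hne id
    rw [h]; exact hy
  rw [← Finset.sum_fiberwise_of_maps_to (s := powersetCard 3 (Icc 1 s)) (t := Icc 1 s)
    (g := fun T => T.sup id)]
  · apply Finset.sum_le_sum
    intro u _
    have : ∑ T ∈ (powersetCard 3 (Icc 1 s)).filter (fun T => T.sup id = u), g (T.sup id)
        = (((powersetCard 3 (Icc 1 s)).filter (fun T => T.sup id = u)).card : ℝ) * g u := by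
      rw [Finset.sum_congr rfl (g := fun _ => g u)]
      · simp
      · intro T hT
        rw [(mem_filter.1 hT).2]
    rw [this]
    apply mul_le_mul_of_nonneg_right _ (hg u)
    have hc : ((powersetCard 3 (Icc 1 s)).filter (fun T => T.sup id = u)).card
        ≤ (powersetCard 2 (Icc 1 u)).card := by
      apply Finset.card_le_card_of_injOn (fun T => T.erase u)
      · intro T hT
        rw [mem_coe, mem_filter] at hT
        obtain ⟨hT, hu⟩ := hT
        have hm := hsup T hT
        rw [hu] at hm
        rw [mem_powersetCard] at hT
        rw [mem_coe, mem_powersetCard]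
        refine ⟨?_, by rw [card_erase_of_mem hm]; omega⟩
        intro y hy
        have hyT := mem_of_mem_erase hy
        have h1 := mem_Icc.1 (hT.1 hyT)
        have h2 : y ≤ T.sup id := le_sup (f := id) hyT
        rw [mem_Icc]; omega
      · intro T hT T' hT' h
        rw [mem_coe, mem_filter] at hT hT'
        have hm := hsup T hT.1
        have hm' := hsup T' hT'.1
        rw [hT.2] at hm
        rw [hT'.2] at hm'
        rw [← insert_erase hm, ← insert_erase hm']
        simp only at h
        rw [h]
    have h2 : (powersetCard 2 (Icc 1 u)).card ≤ u ^ 2 := by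
      rw [card_powersetCard]; simpa using Nat.choose_le_pow u 2
    exact_mod_cast hc.trans h2
  · intro T hT
    exact (mem_powersetCard.1 hT).1 (hsup T hT)

lemma no_K33 (B : Finset ℕ) (hB : CubeFree 9 B) (φ : ℕ → ℕ) (n : ℕ) (T : Finset ℕ)
    (hT : T.card = 3) (hT0 : ∀ u ∈ T, 1 ≤ u) :
    ((Icc 1 n).filter (fun v => ∀ u ∈ T, u * v ∈ B ∧ φ (u * v) = v)).card ≤ 2 := by
  by_contra hcon
  push Not at hcon
  obtain ⟨V, hV, hVc⟩ := Finset.exists_subset_card_eq hcon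
  have hVm : ∀ v ∈ V, 1 ≤ v ∧ ∀ u ∈ T, u * v ∈ B ∧ φ (u * v) = v := by
    intro v hv
    have := mem_filter.1 (hV hv)
    exact ⟨(mem_Icc.1 this.1).1, this.2⟩
  have hinj : Set.InjOn (fun p : ℕ × ℕ => p.1 * p.2) (T ×ˢ V : Finset (ℕ × ℕ)) := by
    rintro ⟨u, v⟩ h ⟨u', v'⟩ h' he
    rw [mem_coe, mem_product] at h h'
    simp only at h h' he
    have e1 := ((hVm v h.2).2 u h.1).2
    have e2 := ((hVm v' h'.2).2 u' h'.1).2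
    have hv : v = v' := by rw [← e1, ← e2, he]
    subst hv
    have := Nat.eq_of_mul_eq_mul_right (hVm v h.2).1 he
    rw [this]
  refine hB ((T ×ˢ V).image (fun p => p.1 * p.2)) ?_ ?_ ((∏ u ∈ T, u) * ∏ v ∈ V, v) ?_ ?_
  · intro y hy
    obtain ⟨⟨u, v⟩, h, rfl⟩ := mem_image.1 hy
    rw [mem_product] at h
    exact ((hVm v h.2).2 u h.1).1
  · rw [card_image_of_injOn hinj, card_product, hT, hVc]
  · apply Nat.mul_pos
    · exact Finset.prod_pos hT0
    · exact Finset.prod_pos (fun v hv => (hVm v hv).1)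
  · rw [prod_image hinj, prod_product]
    have h1 : ∀ u ∈ T, ∏ v ∈ V, u * v = u ^ 3 * ∏ v ∈ V, v := by
      intro u _
      rw [Finset.prod_mul_distrib, Finset.prod_const, hVc]
    rw [Finset.prod_congr rfl h1, Finset.prod_mul_distrib, Finset.prod_const, hT,
      Finset.prod_pow, mul_pow]

lemma count_main (n : ℕ) (x : ℝ) (hx : 0 < x) (hxn : x ^ 6 = n) (d : ℕ → ℕ)
    (hd : ∀ v ∈ Icc 1 n, 0 < d v → v.Prime ∨ v ^ 3 ≤ n ^ 2)
    (hd1 : ∀ v ∈ Icc 1 n, n / 2 < v → d v ≤ 1) :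
    ((∑ v ∈ Icc 1 n, min (d v) 2 : ℕ) : ℝ) ≤
      (Nat.primeCounting n : ℝ) + Nat.primeCounting (n / 2) + 2 * x ^ 4 := by
  have h1 : ∑ v ∈ Icc 1 n, min (d v) 2 ≤ ∑ v ∈ Icc 1 n, ((if v.Prime then 1 else 0)
      + (if v.Prime ∧ v ≤ n / 2 then 1 else 0) + 2 * (if v ^ 3 ≤ n ^ 2 then 1 else 0)) := by
    apply Finset.sum_le_sum
    intro v hv
    rcases Nat.eq_zero_or_pos (d v) with h | h
    · rw [h]; simp
    · by_cases h3 : v ^ 3 ≤ n ^ 2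
      · have : min (d v) 2 ≤ 2 := min_le_right _ _
        simp only [h3, if_true]; omega
      · have hp : v.Prime := (hd v hv h).resolve_right h3
        by_cases h2 : v ≤ n / 2
        · have : min (d v) 2 ≤ 2 := min_le_right _ _
          simp only [hp, h2, if_true, and_self]; omega
        · have := hd1 v hv (by omega)
          simp only [hp, if_true]; omega
  rw [Finset.sum_add_distrib, Finset.sum_add_distrib, ← Finset.mul_sum, Finset.sum_boole,
    Finset.sum_boole, Finset.sum_boole] at h1
  simp only [Nat.cast_id] at h1
  have e1 : ((Icc 1 n).filter Nat.Prime).card = Nat.primeCounting n := by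
    rw [← Nat.primesLE_eq_filter_Icc_one, Nat.primesLE_card_eq_primeCounting]
  have e2 : ((Icc 1 n).filter (fun v => v.Prime ∧ v ≤ n / 2)).card
      = Nat.primeCounting (n / 2) := by
    rw [← Nat.primesLE_card_eq_primeCounting, Nat.primesLE_eq_filter_Icc_one]
    congr 1
    ext v
    simp only [mem_filter, mem_Icc]
    constructor
    · rintro ⟨⟨a, b⟩, c, e⟩; exact ⟨⟨a, e⟩, c⟩
    · rintro ⟨⟨a, b⟩, c⟩; exact ⟨⟨a, by omega⟩, c, b⟩
  have e3 : ((((Icc 1 n).filter (fun v => v ^ 3 ≤ n ^ 2)).card : ℕ) : ℝ) ≤ x ^ 4 := by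
    have hsub : (Icc 1 n).filter (fun v => v ^ 3 ≤ n ^ 2) ⊆ Icc 1 ⌊x ^ 4⌋₊ := by
      intro v hv
      simp only [mem_filter, mem_Icc] at hv ⊢
      refine ⟨hv.1.1, Nat.le_floor ?_⟩
      have : (v : ℝ) ^ 3 ≤ (n : ℝ) ^ 2 := by exact_mod_cast hv.2
      rw [← hxn] at this
      refine le_of_pow_le_pow_left₀ (n := 3) (by norm_num) (by positivity) ?_
      calc (v : ℝ) ^ 3 ≤ _ := this
        _ = _ := by ring
    have := Finset.card_le_card hsub
    rw [Nat.card_Icc, Nat.add_sub_cancel] at this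
    calc _ ≤ ((⌊x ^ 4⌋₊ : ℕ) : ℝ) := by exact_mod_cast this
      _ ≤ _ := Nat.floor_le (by positivity)
  rw [e1, e2] at h1
  have h1' : ((∑ v ∈ Icc 1 n, min (d v) 2 : ℕ) : ℝ) ≤ Nat.primeCounting n
      + Nat.primeCounting (n / 2) + 2 * (((Icc 1 n).filter (fun v => v ^ 3 ≤ n ^ 2)).card : ℕ) := by
    exact_mod_cast h1
  linarith

lemma upper_nine (n : ℕ) (hn : 1 ≤ n) (x : ℝ) (hx : 0 < x) (hxn : x ^ 6 = n)
    (B : Finset ℕ) (hBn : B ⊆ Icc 1 n) (hB : CubeFree 9 B) :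
    (B.card : ℝ) ≤ (Nat.primeCounting n : ℝ) + Nat.primeCounting (n / 2)
      + 2 * x ^ 4 + 9219 * x ^ 5 := by
  classical
  have hφ : ∀ a : ℕ, ∃ v, 1 ≤ a → v ∣ a ∧ a ≤ v * v ∧ (v.Prime ∨ v ^ 3 ≤ a ^ 2) := by
    intro a
    by_cases ha : 1 ≤ a
    · obtain ⟨v, hv⟩ := exists_divisor a ha
      exact ⟨v, fun _ => hv⟩
    · exact ⟨0, fun h => absurd h ha⟩
  choose φ hφ using hφ
  set N : ℕ → Finset ℕ := fun v => (Icc 1 n).filter (fun u => u * v ∈ B ∧ φ (u * v) = v) with hN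
  have hNm : ∀ v u, u ∈ N v → 1 ≤ u ∧ 1 ≤ u * v ∧ u * v ≤ n ∧ u ≤ v ∧
      (v.Prime ∨ v ^ 3 ≤ n ^ 2) := by
    intro v u hu
    rw [hN] at hu
    simp only [mem_filter, mem_Icc] at hu
    obtain ⟨⟨h1, _⟩, hb, he⟩ := hu
    have hbn := mem_Icc.1 (hBn hb)
    obtain ⟨_, h3, h4⟩ := hφ _ hbn.1
    rw [he] at h3 h4
    have hv : 0 < v := by
      rcases Nat.eq_zero_or_pos v with h | h
      · rw [h] at hbn; omega
      · exact h
    refine ⟨h1, hbn.1, hbn.2, Nat.le_of_mul_le_mul_right h3 hv, ?_⟩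
    rcases h4 with h4 | h4
    · exact Or.inl h4
    · exact Or.inr (h4.trans (Nat.pow_le_pow_left hbn.2 2))
  set s := Nat.sqrt n with hs
  have hNs : ∀ v, N v ⊆ Icc 1 s := by
    intro v u hu
    have h := hNm v u hu
    rw [mem_Icc]
    refine ⟨h.1, Nat.le_sqrt.2 ?_⟩
    exact (Nat.mul_le_mul_left u h.2.2.2.1).trans h.2.2.1
  -- card B ≤ ∑ card N v
  have hcard : B.card ≤ ∑ v ∈ Icc 1 n, (N v).card := by
    rw [Finset.card_eq_sum_card_fiberwise (f := φ) (s := B) (t := Icc 1 n)]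
    · apply Finset.sum_le_sum
      intro v hv
      apply Finset.card_le_card_of_injOn (fun a => a / v)
      · intro a ha
        rw [mem_coe, mem_filter] at ha
        obtain ⟨haB, hav⟩ := ha
        have han := mem_Icc.1 (hBn haB)
        obtain ⟨h1, _, _⟩ := hφ a han.1
        rw [hav] at h1
        rw [mem_coe, hN]
        simp only [mem_filter, mem_Icc]
        rw [Nat.div_mul_cancel h1]
        refine ⟨⟨Nat.div_pos (Nat.le_of_dvd han.1 h1) (mem_Icc.1 hv).1, ?_⟩, haB, hav⟩
        exact (Nat.div_le_self _ _).trans han.2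
      · intro a ha b hb hab
        rw [mem_coe, mem_filter] at ha hb
        obtain ⟨h1, _, _⟩ := hφ a (mem_Icc.1 (hBn ha.1)).1
        obtain ⟨h2, _, _⟩ := hφ b (mem_Icc.1 (hBn hb.1)).1
        rw [ha.2] at h1
        rw [hb.2] at h2
        simp only at hab
        rw [← Nat.div_mul_cancel h1, ← Nat.div_mul_cancel h2, hab]
    · intro a ha
      have han := mem_Icc.1 (hBn ha)
      obtain ⟨h1, h2, _⟩ := hφ a han.1
      rw [mem_coe, mem_Icc]
      exact ⟨Nat.pos_of_dvd_of_pos h1 han.1, (Nat.le_of_dvd han.1 h1).trans han.2⟩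
  -- the bound of main part
  have hmain := count_main n x hx hxn (fun v => (N v).card)
    (by
      intro v _ h
      obtain ⟨u, hu⟩ := card_pos.1 h
      exact (hNm v u hu).2.2.2.2)
    (by
      intro v _ h
      rw [Finset.card_le_one]
      have : ∀ u ∈ N v, u = 1 := by
        intro u hu
        have h := hNm v u hu
        by_contra hne
        have : 2 * v ≤ u * v := Nat.mul_le_mul_right v (by omega)
        omega
      intro a ha b hb
      rw [this a ha, this b hb])
  set t : ℕ → ℝ := fun v => x ^ 6 / (x + cb v) ^ 4 with ht
  have htpos : ∀ v, 0 < t v := by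
    intro v
    have := cb_nonneg v
    simp only [ht]; positivity
  have hsum_t : ∑ v ∈ Icc 1 n, t v ≤ 3 * x ^ 5 := by
    refine (sum_t x hx n).trans ?_
    have h1 : 0 ≤ 1 / (x + cb n) := by have := cb_nonneg n; positivity
    have h2 : 3 * x ^ 6 * (1 / x - 1 / (x + cb n)) ≤ 3 * x ^ 6 * (1 / x) := by
      gcongr; linarith
    refine h2.trans (le_of_eq ?_)
    field_simp
  set g : ℕ → ℝ := fun u => 2 * (256 * x ^ 4 / cb u ^ 8) with hg
  have hgnn : ∀ u, 0 ≤ g u := by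
    intro u; have := cb_nonneg u; simp only [hg]; positivity
  have hw : ∀ v, ∀ u ∈ N v, 1 / t v ^ 2 ≤ 256 * x ^ 4 / cb u ^ 8 := by
    intro v u hu
    have h := hNm v u hu
    have hru := cb_pos u h.1
    have hrv := cb_nonneg v
    have hcu := cb_cube u
    have hcv := cb_cube v
    have a1 : cb u ≤ x := by
      refine le_of_pow_le_pow_left₀ (n := 6) (by norm_num) hx.le ?_
      rw [hxn]
      calc cb u ^ 6 = (u : ℝ) * u := by rw [← hcu]; ring
        _ ≤ n := by exact_mod_cast (Nat.mul_le_mul_left u h.2.2.2.1).trans h.2.2.1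
    have a2 : cb u * cb v ≤ x ^ 2 := by
      refine le_of_pow_le_pow_left₀ (n := 3) (by norm_num) (by positivity) ?_
      calc (cb u * cb v) ^ 3 = (u : ℝ) * v := by rw [← hcu, ← hcv]; ring
        _ ≤ n := by exact_mod_cast h.2.2.1
        _ = _ := by rw [← hxn]; ring
    have a3 : cb u * (x + cb v) ≤ 2 * x ^ 2 := by nlinarith
    have a4 : (cb u * (x + cb v)) ^ 8 ≤ (2 * x ^ 2) ^ 8 := by gcongr
    have e : 1 / t v ^ 2 = (x + cb v) ^ 8 / x ^ 12 := by
      simp only [ht]; field_simp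
    rw [e, div_le_div_iff₀ (by positivity) (by positivity)]
    calc (x + cb v) ^ 8 * cb u ^ 8 = (cb u * (x + cb v)) ^ 8 := by ring
      _ ≤ _ := a4
      _ = _ := by ring
  have htrip : ∑ v ∈ Icc 1 n, ((((N v).card.choose 3 : ℕ) : ℝ) * (1 / t v ^ 2))
      ≤ ∑ T ∈ powersetCard 3 (Icc 1 s), g (T.sup id) := by
    have e : ∀ v ∈ Icc 1 n, ((((N v).card.choose 3 : ℕ) : ℝ) * (1 / t v ^ 2))
        = ∑ T ∈ powersetCard 3 (Icc 1 s), if T ⊆ N v then 1 / t v ^ 2 else 0 := by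
      intro v _
      rw [← Finset.sum_filter, Finset.sum_const, nsmul_eq_mul]
      congr 2
      rw [← card_powersetCard]
      congr 1
      ext T
      simp only [mem_filter, mem_powersetCard]
      constructor
      · rintro ⟨a, b⟩; exact ⟨⟨a.trans (hNs v), b⟩, a⟩
      · rintro ⟨⟨a, b⟩, c⟩; exact ⟨c, b⟩
    rw [Finset.sum_congr rfl e, Finset.sum_comm]
    apply Finset.sum_le_sum
    intro T hT
    rw [mem_powersetCard] at hT
    rw [← Finset.sum_filter]
    have hne : T.Nonempty := by rw [← card_pos]; omega
    obtain ⟨y, hy, hyy⟩ := exists_mem_eq_sup T hne id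
    have hle : ∀ v ∈ (Icc 1 n).filter (fun v => T ⊆ N v), 1 / t v ^ 2
        ≤ 256 * x ^ 4 / cb (T.sup id) ^ 8 := by
      intro v hv
      rw [hyy]
      exact hw v y ((mem_filter.1 hv).2 hy)
    refine (Finset.sum_le_card_nsmul _ _ _ hle).trans ?_
    rw [nsmul_eq_mul]
    simp only [hg]
    have := cb_nonneg (T.sup id)
    apply mul_le_mul_of_nonneg_right _ (by positivity)
    have h33 := no_K33 B hB φ n T hT.2 (fun u hu => (mem_Icc.1 (hT.1 hu)).1)
    have hsub : (Icc 1 n).filter (fun v => T ⊆ N v) ⊆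
        (Icc 1 n).filter (fun v => ∀ u ∈ T, u * v ∈ B ∧ φ (u * v) = v) := by
      intro v hv
      rw [mem_filter] at hv ⊢
      refine ⟨hv.1, fun u hu => ?_⟩
      have := hv.2 hu
      rw [hN] at this
      exact (mem_filter.1 this).2
    exact_mod_cast (card_le_card hsub).trans h33
  have htrip2 := sum_triples s g hgnn
  have hfin : ∑ u ∈ Icc 1 s, (u : ℝ) ^ 2 * g u ≤ 1536 * x ^ 5 := by
    have e : ∀ u ∈ Icc 1 s, (u : ℝ) ^ 2 * g u = 512 * x ^ 4 * (1 / cb u ^ 2) := by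
      intro u hu
      have hp := cb_pos u (mem_Icc.1 hu).1
      simp only [hg]
      rw [← cb_cube u]
      field_simp
      norm_num
    rw [Finset.sum_congr rfl e, ← Finset.mul_sum]
    have h1 := sum_inv_sq s
    have h2 : cb s ≤ x := by
      refine le_of_pow_le_pow_left₀ (n := 6) (by norm_num) hx.le ?_
      rw [hxn]
      calc cb s ^ 6 = (s : ℝ) * s := by rw [← cb_cube s]; ring
        _ ≤ n := by exact_mod_cast Nat.sqrt_le n
    calc 512 * x ^ 4 * _ ≤ 512 * x ^ 4 * (3 * x) := by gcongr; linarith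
      _ = _ := by ring
  have hB1 : (B.card : ℝ) ≤ ∑ v ∈ Icc 1 n, ((N v).card : ℝ) := by exact_mod_cast hcard
  have hB2 : ∑ v ∈ Icc 1 n, ((N v).card : ℝ) ≤ ∑ v ∈ Icc 1 n, (((min (N v).card 2 : ℕ) : ℝ)
      + t v + 6 * ((((N v).card.choose 3 : ℕ) : ℝ) * (1 / t v ^ 2))) :=
    Finset.sum_le_sum (fun v _ => deg_ineq _ _ (htpos v))
  rw [Finset.sum_add_distrib, Finset.sum_add_distrib, ← Finset.mul_sum] at hB2
  rw [Nat.cast_sum] at hmain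
  linarith

lemma upper_bound (ℓ n : ℕ) (hℓ : 1 ≤ ℓ) (hn : 1 ≤ n) :
    (Fkd (36 * ℓ) 3 n : ℝ) ≤ (Nat.primeCounting n : ℝ) + (Nat.primeCounting (n / 2) : ℝ)
            + (9221 + 36 * ℓ) * (n : ℝ) ^ ((5 : ℝ)/6) := by
  obtain ⟨A, hA, hfree, hc⟩ := Fkd_attained (36 * ℓ) n (by omega)
  obtain ⟨B, hBA, hB9, hcard⟩ := reduce_nine (4 * ℓ - 1) A (by
    have : 9 * (4 * ℓ - 1 + 1) = 36 * ℓ := by omega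
    rwa [this])
  have hn1 : (1 : ℝ) ≤ n := by exact_mod_cast hn
  set x : ℝ := (n : ℝ) ^ ((1 : ℝ) / 6) with hx
  have hx1 : 1 ≤ x := Real.one_le_rpow hn1 (by norm_num)
  have hx6 : x ^ 6 = n := by
    rw [hx, ← Real.rpow_natCast, ← Real.rpow_mul (by positivity)]; norm_num
  have hx5 : (n : ℝ) ^ ((5 : ℝ) / 6) = x ^ 5 := by
    rw [hx, ← Real.rpow_natCast, ← Real.rpow_mul (by positivity)]; norm_num
  have h := upper_nine n hn x (by linarith) hx6 B (hBA.trans hA) hB9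
  rw [hc, hx5]
  have h1 : (A.card : ℝ) ≤ B.card + 36 * ℓ := by
    have : A.card ≤ B.card + 36 * ℓ := by omega
    exact_mod_cast this
  have h4 : x ^ 4 ≤ x ^ 5 := pow_le_pow_right₀ hx1 (by norm_num)
  have h5 : 1 ≤ x ^ 5 := one_le_pow₀ hx1
  have h6 : (36 * (ℓ : ℝ)) * 1 ≤ 36 * ℓ * x ^ 5 := by gcongr
  linarith

lemma averaging {α : Type*} [Fintype α] [DecidableEq α] (k q : ℕ) (hk : 1 ≤ k) (hq : 1 ≤ q)
    (F : Finset (Finset α)) (hF : ∀ T ∈ F, T.card = k) (hc : F.card ≤ q ^ k) :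
    ∃ I : Finset α, (∀ T ∈ F, ¬ T ⊆ I) ∧ Fintype.card α ≤ q * (I.card + 1) := by
  classical
  obtain ⟨q, rfl⟩ : ∃ q', q = q' + 1 := ⟨q - 1, by omega⟩
  let Z : (α → Fin (q + 1)) → Finset α := fun f => Finset.univ.filter (fun e => f e = 0)
  -- number of functions vanishing on T
  have hcount : ∀ T : Finset α, (q + 1) ^ T.card *
      (Finset.univ.filter (fun f : α → Fin (q + 1) => T ⊆ Z f)).card
        = (q + 1) ^ Fintype.card α := by
    intro T
    have e : Finset.univ.filter (fun f : α → Fin (q + 1) => T ⊆ Z f)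
        = Fintype.piFinset (fun e => if e ∈ T then {0} else Finset.univ) := by
      ext f
      simp only [mem_filter, mem_univ, true_and, Fintype.mem_piFinset, Z]
      constructor
      · intro h e
        by_cases he : e ∈ T
        · have := h he
          simp only [mem_filter, mem_univ, true_and] at this
          simp [he, this]
        · simp [he]
      · intro h e he
        have := h e
        simp only [he, if_true, mem_singleton] at this
        simp [this]
    rw [e, Fintype.card_piFinset]
    have e2 : ∀ e : α, (if e ∈ T then ({0} : Finset (Fin (q + 1))) else Finset.univ).card
        = if e ∈ T then 1 else (q + 1) := by
      intro e
      by_cases he : e ∈ T <;> simp [he]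
    rw [Finset.prod_congr rfl (fun e _ => e2 e), Finset.prod_ite]
    simp only [prod_const_one, one_mul, prod_const]
    rw [← pow_add]
    congr 1
    have := Finset.card_filter_add_card_filter_not (s := (Finset.univ : Finset α)) (fun e => e ∈ T)
    rw [Finset.card_univ] at this
    have h3 : (Finset.univ.filter (fun e => e ∈ T)).card = T.card := by simp
    omega
  let bad : (α → Fin (q + 1)) → Finset (Finset α) := fun f => F.filter (fun T => T ⊆ Z f)
  have h1 : (q + 1) * ∑ f, (Z f).card = Fintype.card α * (q + 1) ^ Fintype.card α := by
    have : ∑ f, (Z f).card = ∑ e : α,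
        (Finset.univ.filter (fun f : α → Fin (q + 1) => {e} ⊆ Z f)).card := by
      simp only [Finset.card_filter, Z]
      rw [Finset.sum_comm]
      simp
    rw [this, Finset.mul_sum]
    have e : ∀ e : α, (q + 1) *
        (Finset.univ.filter (fun f : α → Fin (q + 1) => {e} ⊆ Z f)).card
        = (q + 1) ^ Fintype.card α := by
      intro e
      have := hcount {e}
      rwa [card_singleton, pow_one] at this
    rw [Finset.sum_congr rfl (fun x _ => e x)]
    simp
  have h2 : ∑ f, (bad f).card ≤ (q + 1) ^ Fintype.card α := by
    have : ∑ f, (bad f).card = ∑ T ∈ F,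
        (Finset.univ.filter (fun f : α → Fin (q + 1) => T ⊆ Z f)).card := by
      simp only [Finset.card_filter, bad]
      rw [Finset.sum_comm]
    have h3 : (q + 1) ^ k * ∑ f, (bad f).card = F.card * (q + 1) ^ Fintype.card α := by
      rw [this, Finset.mul_sum]
      rw [Finset.sum_congr rfl (g := fun _ => (q + 1) ^ Fintype.card α)]
      · simp
      · intro T hT
        rw [← hcount T, hF T hT]
    have h4 : (q + 1) ^ k * ∑ f, (bad f).card ≤ (q + 1) ^ k * (q + 1) ^ Fintype.card α := by
      rw [h3]; exact Nat.mul_le_mul_right _ hc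
    exact Nat.le_of_mul_le_mul_left h4 (by positivity)
  obtain ⟨f, hf⟩ : ∃ f : α → Fin (q + 1),
      Fintype.card α + (q + 1) * (bad f).card ≤ (q + 1) * ((Z f).card + 1) := by
    by_contra hcon
    push Not at hcon
    have : ∑ f : α → Fin (q + 1), (q + 1) * ((Z f).card + 1)
        < ∑ f : α → Fin (q + 1), (Fintype.card α + (q + 1) * (bad f).card) :=
      Finset.sum_lt_sum_of_nonempty ⟨fun _ => 0, mem_univ _⟩ (fun f _ => hcon f)
    rw [← Finset.mul_sum, Finset.sum_add_distrib, Finset.sum_add_distrib, ← Finset.mul_sum,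
      mul_add, h1] at this
    simp only [sum_const, card_univ, Fintype.card_fun, Fintype.card_fin, smul_eq_mul,
      mul_one] at this
    have h5 := Nat.mul_le_mul_left (q + 1) h2
    have h6 := mul_comm (Fintype.card α) ((q + 1) ^ Fintype.card α)
    omega
  have hpick : ∀ T : Finset α, ∃ e : Finset α, e.card ≤ 1 ∧ (T.card = k → ∃ y ∈ e, y ∈ T) := by
    intro T
    by_cases hT : T.card = k
    · obtain ⟨y, hy⟩ : T.Nonempty := by rw [← card_pos]; omega
      exact ⟨{y}, by simp, fun _ => ⟨y, by simp, hy⟩⟩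
    · exact ⟨∅, by simp, fun h => absurd h hT⟩
  choose pick hp1 hp2 using hpick
  refine ⟨Z f \ (bad f).biUnion pick, ?_, ?_⟩
  · intro T hT hsub
    have hTb : T ∈ bad f := mem_filter.2 ⟨hT, hsub.trans sdiff_subset⟩
    obtain ⟨y, hy, hyT⟩ := hp2 T (hF T hT)
    exact (mem_sdiff.1 (hsub hyT)).2 (mem_biUnion.2 ⟨T, hTb, hy⟩)
  · have hb : ((bad f).biUnion pick).card ≤ (bad f).card := by
      have := Finset.card_biUnion_le_card_mul (bad f) pick 1 (fun T _ => hp1 T)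
      omega
    have hs := Finset.le_card_sdiff ((bad f).biUnion pick) (Z f)
    have : (Z f).card + 1 ≤ (Z f \ (bad f).biUnion pick).card + 1 + (bad f).card := by omega
    have h7 := Nat.mul_le_mul_left (q + 1) this
    rw [mul_add (q + 1) (_ + 1) ((bad f).card)] at h7
    omega

lemma averaging' (E : Finset ℕ) (k q : ℕ) (hk : 1 ≤ k) (hq : 1 ≤ q)
    (F : Finset (Finset ℕ)) (hF : ∀ T ∈ F, T ⊆ E ∧ T.card = k) (hc : F.card ≤ q ^ k) :
    ∃ I ⊆ E, (∀ T ∈ F, ¬ T ⊆ I) ∧ E.card ≤ q * (I.card + 1) := by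
  classical
  obtain ⟨I, h1, h2⟩ := averaging (α := E) k q hk hq
    (F.image (fun T => T.subtype (· ∈ E))) (by
      intro T hT
      obtain ⟨T, hTF, rfl⟩ := mem_image.1 hT
      replace hT := hTF
      rw [card_subtype, filter_true_of_mem (fun x hx => (hF T hT).1 hx)]
      exact (hF T hT).2) (card_image_le.trans hc)
  refine ⟨I.map (Function.Embedding.subtype _), ?_, ?_, ?_⟩
  · intro x hx
    obtain ⟨y, _, rfl⟩ := mem_map.1 hx
    exact y.2
  · intro T hT hsub
    refine h1 _ (mem_image.2 ⟨T, hT, rfl⟩) ?_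
    intro y hy
    rw [mem_subtype] at hy
    obtain ⟨z, hz, hzy⟩ := mem_map.1 (hsub hy)
    have : z = y := Subtype.ext hzy
    rwa [← this]
  · rw [card_map]
    simpa using h2

open ArithmeticFunction in
lemma cardFactors_prod' (S : Finset ℕ) (h : ∀ a ∈ S, a ≠ 0 ∧ cardFactors a = 2) :
    cardFactors (∏ a ∈ S, a) = 2 * S.card := by
  classical
  induction S using Finset.induction_on with
  | empty => simp
  | insert a S ha ih =>
    rw [prod_insert ha, cardFactors_mul (h a (mem_insert_self _ _)).1
      (Finset.prod_ne_zero_iff.2 (fun b hb => (h b (mem_insert_of_mem hb)).1)),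
      ih (fun b hb => h b (mem_insert_of_mem hb)), (h a (mem_insert_self _ _)).2,
      card_insert_of_notMem ha]
    ring

open ArithmeticFunction in
lemma bad_count (P : Finset ℕ) (hP : ∀ p ∈ P, p.Prime) (ℓ : ℕ) (hPc : 24 * ℓ ≤ P.card)
    (F : Finset (Finset ℕ))
    (hF : ∀ T ∈ F, T ⊆ (P ×ˢ P).image (fun z => z.1 * z.2) ∧ T.card = 36 * ℓ ∧
      ∃ x : ℕ, 0 < x ∧ ∏ a ∈ T, a = x ^ 3) :
    F.card ≤ P.card ^ (24 * ℓ) * 2 ^ ((24 * ℓ) * (24 * ℓ)) := by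
  classical
  have hsub : F ⊆ (powersetCard (24 * ℓ) P).biUnion
      (fun W => ((W ×ˢ W).image (fun z => z.1 * z.2)).powerset) := by
    intro T hT
    obtain ⟨hTE, hTc, x, hx, hprod⟩ := hF T hT
    have hel : ∀ a ∈ T, a ≠ 0 ∧ cardFactors a = 2 := by
      intro a ha
      obtain ⟨⟨p, r⟩, hz, rfl⟩ := mem_image.1 (hTE ha)
      rw [mem_product] at hz
      have hp := hP p hz.1
      have hr := hP r hz.2
      refine ⟨(Nat.mul_pos hp.pos hr.pos).ne', ?_⟩
      simp only
      rw [cardFactors_mul hp.ne_zero hr.ne_zero, cardFactors_apply_prime hp,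
        cardFactors_apply_prime hr]
    have h1 := cardFactors_prod' T hel
    rw [hprod, cardFactors_pow, hTc] at h1
    have h2 : x.primeFactors.card ≤ 24 * ℓ := by
      have : x.primeFactors.card ≤ cardFactors x := by
        rw [cardFactors_apply, Nat.primeFactors]
        exact List.toFinset_card_le _
      omega
    have hdvd : ∀ p, p.Prime → ∀ a ∈ T, p ∣ a → p ∈ x.primeFactors := by
      intro p hp a ha hpa
      have : p ∣ x ^ 3 := by rw [← hprod]; exact hpa.trans (Finset.dvd_prod_of_mem _ ha)
      exact Nat.mem_primeFactors.2 ⟨hp, hp.dvd_of_dvd_pow this, hx.ne'⟩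
    have h3 : x.primeFactors ⊆ P := by
      intro p hp
      have hpp := Nat.prime_of_mem_primeFactors hp
      have : p ∣ ∏ a ∈ T, a := by
        rw [hprod]; exact (Nat.dvd_of_mem_primeFactors hp).trans (dvd_pow_self _ (by norm_num))
      obtain ⟨a, ha, hpa⟩ := (hpp.prime.dvd_finsetProd_iff _).1 this
      obtain ⟨⟨p', r⟩, hz, rfl⟩ := mem_image.1 (hTE ha)
      rw [mem_product] at hz
      rcases hpp.dvd_mul.1 hpa with h | h
      · rw [(Nat.prime_dvd_prime_iff_eq hpp (hP _ hz.1)).1 h]; exact hz.1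
      · rw [(Nat.prime_dvd_prime_iff_eq hpp (hP _ hz.2)).1 h]; exact hz.2
    obtain ⟨W, hW1, hW2, hW3⟩ := Finset.exists_subsuperset_card_eq h3 h2 hPc
    refine mem_biUnion.2 ⟨W, mem_powersetCard.2 ⟨hW2, hW3⟩, mem_powerset.2 ?_⟩
    intro a ha
    obtain ⟨⟨p, r⟩, hz, rfl⟩ := mem_image.1 (hTE ha)
    rw [mem_product] at hz
    refine mem_image.2 ⟨(p, r), mem_product.2 ⟨?_, ?_⟩, rfl⟩
    · exact hW1 (hdvd p (hP p hz.1) _ ha (Dvd.intro _ rfl))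
    · exact hW1 (hdvd r (hP r hz.2) _ ha (Dvd.intro_left _ rfl))
  refine (card_le_card hsub).trans ?_
  refine (Finset.card_biUnion_le_card_mul _ _ (2 ^ ((24 * ℓ) * (24 * ℓ))) ?_).trans ?_
  · intro W hW
    rw [card_powerset]
    apply Nat.pow_le_pow_right (by norm_num)
    refine card_image_le.trans ?_
    rw [card_product, (mem_powersetCard.1 hW).2]
  · apply Nat.mul_le_mul_right
    rw [card_powersetCard]
    exact Nat.choose_le_pow _ _

lemma card_E (P : Finset ℕ) (hP : ∀ p ∈ P, p.Prime) :
    P.card * P.card ≤ 2 * ((P ×ˢ P).image (fun z => z.1 * z.2)).card := by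
  classical
  rw [← card_product]
  apply Finset.card_le_mul_card_image
  intro a ha
  obtain ⟨⟨p, r⟩, hz, rfl⟩ := mem_image.1 ha
  rw [mem_product] at hz
  have hp := hP p hz.1
  have hr := hP r hz.2
  refine (card_le_card (t := {(p, r), (r, p)}) ?_).trans Finset.card_le_two
  rintro ⟨p', r'⟩ h
  rw [mem_filter, mem_product] at h
  obtain ⟨⟨h1, h2⟩, h3⟩ := h
  simp only at h1 h2 h3 hz
  have hp' := hP p' h1
  have hr' := hP r' h2
  have hd : p' ∣ p * r := by rw [← h3]; exact Dvd.intro _ rfl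
  rcases hp'.dvd_mul.1 hd with h | h
  · have := (Nat.prime_dvd_prime_iff_eq hp' hp).1 h
    subst this
    have := Nat.eq_of_mul_eq_mul_left hp'.pos h3
    simp [this]
  · have := (Nat.prime_dvd_prime_iff_eq hp' hr).1 h
    subst this
    rw [mul_comm p] at h3
    have := Nat.eq_of_mul_eq_mul_left hp'.pos h3
    simp [this]

lemma lower_comb (ℓ n q : ℕ) (hℓ : 1 ≤ ℓ) (hq : 1 ≤ q) (hs : 2 ≤ Nat.sqrt n)
    (hN : 24 * ℓ ≤ Nat.primeCounting (Nat.sqrt n))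
    (hqN : Nat.primeCounting (Nat.sqrt n) ^ (24 * ℓ) * 2 ^ ((24 * ℓ) * (24 * ℓ)) ≤ q ^ (36 * ℓ)) :
    ∃ m : ℕ, Nat.primeCounting (Nat.sqrt n) * Nat.primeCounting (Nat.sqrt n) ≤ 2 * (q * (m + 1)) ∧
      Nat.primeCounting n + Nat.primeCounting (n / 2) + m
        ≤ Fkd (36 * ℓ) 3 n + 2 * Nat.primeCounting (Nat.sqrt n) := by
  classical
  set s := Nat.sqrt n with hsdef
  set P := Nat.primesLE s with hPdef
  have hPc : P.card = Nat.primeCounting s := Nat.primesLE_card_eq_primeCounting s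
  have hP : ∀ p ∈ P, p.Prime := fun p hp => Nat.prime_of_mem_primesLE hp
  rw [← hPc] at hN hqN ⊢
  set E := (P ×ˢ P).image (fun z => z.1 * z.2) with hE
  set F := (powersetCard (36 * ℓ) E).filter
    (fun T => ∃ x : ℕ, 0 < x ∧ ∏ a ∈ T, a = x ^ 3) with hF
  have hFm : ∀ T ∈ F, T ⊆ E ∧ T.card = 36 * ℓ ∧ ∃ x : ℕ, 0 < x ∧ ∏ a ∈ T, a = x ^ 3 := by
    intro T hT
    rw [hF, mem_filter, mem_powersetCard] at hT
    exact ⟨hT.1.1, hT.1.2, hT.2⟩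
  have hFc := bad_count P hP ℓ hN F hFm
  obtain ⟨I, hIE, hIF, hIc⟩ := averaging' E (36 * ℓ) q (by omega) hq F
    (fun T hT => ⟨(hFm T hT).1, (hFm T hT).2.1⟩) (hFc.trans hqN)
  refine ⟨I.card, ?_, ?_⟩
  · exact (card_E P hP).trans (Nat.mul_le_mul_left 2 hIc)
  -- the set
  set A1 := Nat.primesLE n \ P with hA1
  set A2 := (Nat.primesLE (n / 2) \ P).image (fun p => 2 * p) with hA2
  have mA1 : ∀ a ∈ A1, a.Prime ∧ s < a ∧ a ≤ n := by
    intro a ha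
    rw [hA1, Finset.mem_sdiff, Nat.mem_primesLE, hPdef, Nat.mem_primesLE] at ha
    refine ⟨ha.1.2, ?_, ha.1.1⟩
    by_contra h
    exact ha.2 ⟨not_lt.1 h, ha.1.2⟩
  have mA2 : ∀ a ∈ A2, ∃ p, a = 2 * p ∧ p.Prime ∧ s < p ∧ p ≤ n / 2 := by
    intro a ha
    obtain ⟨p, hp, rfl⟩ := mem_image.1 ha
    rw [Finset.mem_sdiff, Nat.mem_primesLE, hPdef, Nat.mem_primesLE] at hp
    refine ⟨p, rfl, hp.1.2, ?_, hp.1.1⟩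
    by_contra h
    exact hp.2 ⟨not_lt.1 h, hp.1.2⟩
  have mI : ∀ a ∈ I, ∃ p r, a = p * r ∧ p.Prime ∧ r.Prime ∧ p ≤ s ∧ r ≤ s := by
    intro a ha
    obtain ⟨⟨p, r⟩, hz, rfl⟩ := mem_image.1 (hIE ha)
    rw [mem_product, hPdef, Nat.mem_primesLE, Nat.mem_primesLE] at hz
    exact ⟨p, r, rfl, hz.1.2, hz.2.2, hz.1.1, hz.2.1⟩
  -- no prime > s divides an element of I
  have hIdvd : ∀ a ∈ I, ∀ p, p.Prime → s < p → ¬ p ∣ a := by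
    intro a ha p hp hps hpa
    obtain ⟨p', r, rfl, hp', hr, h1, h2⟩ := mI a ha
    rcases hp.dvd_mul.1 hpa with h | h
    · rw [(Nat.prime_dvd_prime_iff_eq hp hp').1 h] at hps; omega
    · rw [(Nat.prime_dvd_prime_iff_eq hp hr).1 h] at hps; omega
  have d12 : Disjoint A1 A2 := by
    rw [Finset.disjoint_left]
    intro a h1 h2
    obtain ⟨p, rfl, hp, _, _⟩ := mA2 a h2
    exact Nat.not_prime_mul (by norm_num) hp.one_lt.ne' (mA1 _ h1).1
  have d3 : Disjoint (A1 ∪ A2) I := by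
    rw [Finset.disjoint_left]
    intro a h1 h2
    rcases mem_union.1 h1 with h | h
    · obtain ⟨hp, hps, _⟩ := mA1 a h
      exact hIdvd a h2 a hp hps dvd_rfl
    · obtain ⟨p, rfl, hp, hps, _⟩ := mA2 a h
      exact hIdvd _ h2 p hp hps (Dvd.intro_left _ rfl)
  have hsub : (A1 ∪ A2) ∪ I ⊆ Icc 1 n := by
    intro a ha
    rw [mem_Icc]
    rcases mem_union.1 ha with h | h
    · rcases mem_union.1 h with h | h
      · obtain ⟨hp, _, h2⟩ := mA1 a h
        exact ⟨hp.one_lt.le, h2⟩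
      · obtain ⟨p, rfl, hp, _, h2⟩ := mA2 a h
        have := hp.pos
        omega
    · obtain ⟨p, r, rfl, hp, hr, h1, h2⟩ := mI a h
      refine ⟨Nat.mul_pos hp.pos hr.pos, ?_⟩
      exact (Nat.mul_le_mul h1 h2).trans (Nat.sqrt_le n)
  have hfree : CubeFree (36 * ℓ) ((A1 ∪ A2) ∪ I) := by
    intro S hS hSc x hx hprod
    have hS0 : ∀ a ∈ S, a ≠ 0 := by
      intro a ha
      have := mem_Icc.1 (hsub (hS ha))
      omega
    -- large primes do not divide x
    have hbig : ∀ p, p.Prime → s < p → ∀ a ∈ S, ¬ p ∣ a := by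
      intro p hp hps a ha hpa
      have hpx : p ∣ x := by
        apply hp.dvd_of_dvd_pow (n := 3)
        rw [← hprod]
        exact hpa.trans (Finset.dvd_prod_of_mem _ ha)
      have h1 : (∏ a ∈ S, a).factorization p = ∑ a ∈ S, a.factorization p := by
        rw [Nat.factorization_prod hS0]
        simp [Finsupp.finsetSum_apply]
      have h2 : 3 ≤ (∏ a ∈ S, a).factorization p := by
        rw [hprod, Nat.factorization_pow]
        have : 1 ≤ x.factorization p :=
          (hp.dvd_iff_one_le_factorization hx.ne').1 hpx
        simp only [Finsupp.smul_apply, smul_eq_mul]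
        omega
      have h3 : ∀ b ∈ S, b.factorization p ≤ if b ∈ ({p, 2 * p} : Finset ℕ) then 1 else 0 := by
        intro b hb
        have hval1 : p.factorization p = 1 := hp.factorization_self
        by_cases hpb : p ∣ b
        · have hbm : b = p ∨ b = 2 * p := by
            rcases mem_union.1 (hS hb) with h | h
            · rcases mem_union.1 h with h | h
              · left
                exact ((Nat.prime_dvd_prime_iff_eq hp (mA1 b h).1).1 hpb).symm
              · right
                obtain ⟨p', rfl, hp', _, _⟩ := mA2 b h
                rcases hp.dvd_mul.1 hpb with h | h
                · have := Nat.le_of_dvd (by norm_num) h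
                  omega
                · rw [(Nat.prime_dvd_prime_iff_eq hp hp').1 h]
            · exact absurd hpb (hIdvd b h p hp hps)
          rcases hbm with rfl | rfl
          · simp [hval1]
          · rw [Nat.factorization_mul (by norm_num) hp.ne_zero]
            have : (2 : ℕ).factorization p = 0 := by
              apply Nat.factorization_eq_zero_of_not_dvd
              intro h
              have := Nat.le_of_dvd (by norm_num) h
              omega
            simp [this, hval1]
        · rw [Nat.factorization_eq_zero_of_not_dvd hpb]
          exact Nat.zero_le _
      have h4 : ∑ a ∈ S, a.factorization p ≤ 2 := by
        refine (Finset.sum_le_sum h3).trans ?_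
        rw [← Finset.card_filter]
        refine (card_le_card (t := {p, 2 * p}) ?_).trans Finset.card_le_two
        intro b hb
        exact (mem_filter.1 hb).2
      omega
    have hSI : S ⊆ I := by
      intro a ha
      rcases mem_union.1 (hS ha) with h | h
      · rcases mem_union.1 h with h | h
        · exact absurd dvd_rfl (hbig a (mA1 a h).1 (mA1 a h).2.1 a ha)
        · obtain ⟨p, rfl, hp, hps, _⟩ := mA2 a h
          exact absurd (Dvd.intro_left _ rfl) (hbig p hp hps _ ha)
      · exact h
    refine hIF S ?_ hSI
    rw [hF, mem_filter, mem_powersetCard]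
    exact ⟨⟨hSI.trans hIE, hSc⟩, x, hx, hprod⟩
  have hle := le_Fkd (36 * ℓ) n _ hsub hfree
  rw [card_union_of_disjoint d3, card_union_of_disjoint d12] at hle
  have c1 : Nat.primeCounting n - P.card ≤ A1.card := by
    rw [hA1, ← Nat.primesLE_card_eq_primeCounting]
    exact le_card_sdiff _ _
  have c2 : Nat.primeCounting (n / 2) - P.card ≤ A2.card := by
    rw [hA2, card_image_of_injective _ (fun a b h => by simpa using h),
      ← Nat.primesLE_card_eq_primeCounting]
    exact le_card_sdiff _ _
  omega

lemma pi_lower (x : ℝ) (hx : 30 ≤ x) : x / (4 * Real.log x) ≤ Nat.primeCounting ⌊x⌋₊ := by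
  have h := Chebyshev.pi_ge' (x := x) (by linarith)
  have hlog : 0 < Real.log x := Real.log_pos (by linarith)
  refine le_trans ?_ h
  rw [div_le_div_iff₀ (by positivity) hlog]
  have h1 : Real.log (x + 2) ≤ (x + 2) / 8 - 1 + 3 * Real.log 2 := by
    have : Real.log ((x + 2) / 8) ≤ (x + 2) / 8 - 1 := Real.log_le_sub_one_of_pos (by linarith)
    rw [Real.log_div (by linarith) (by norm_num), show (8 : ℝ) = 2 ^ 3 by norm_num,
      Real.log_pow] at this
    push_cast at this
    norm_num at this ⊢
    linarith
  have l1 := Real.log_two_gt_d9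
  have l2 := Real.log_two_lt_d9
  have h2 : x ≤ ((x - 1) * Real.log 2 - Real.log (x + 2)) * 4 := by nlinarith
  nlinarith

lemma lower_bound (ℓ : ℕ) (hℓ : 1 ≤ ℓ) : ∃ c1 : ℝ, 0 < c1 ∧ ∀ᶠ n : ℕ in Filter.atTop,
      (Nat.primeCounting n : ℝ) + (Nat.primeCounting (n / 2) : ℝ)
          + c1 * (n : ℝ) ^ ((9 * (ℓ : ℝ)) / (18 * (ℓ : ℝ) - 2))
              / (Real.log n) ^ ((9 * (ℓ : ℝ)) / (9 * (ℓ : ℝ) - 1))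
        ≤ (Fkd (36 * ℓ) 3 n : ℝ) := by
  set K : ℝ := 2 ^ (16 * ℓ) with hK
  have hKpos : 0 < K := by positivity
  set κ : ℝ := 1 / (4 * K) with hκ
  have hκpos : 0 < κ := by positivity
  refine ⟨κ / 2 * (1 / 4) ^ ((4 : ℝ) / 3), by positivity, ?_⟩
  have hsq : Tendsto Nat.sqrt atTop atTop := by
    refine tendsto_atTop.2 (fun b => ?_)
    filter_upwards [eventually_ge_atTop (b * b)] with n hn
    exact Nat.le_sqrt.2 hn
  have hNt : Tendsto (fun n => Nat.primeCounting (Nat.sqrt n)) atTop atTop :=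
    Nat.tendsto_primeCounting.comp hsq
  have hNr : Tendsto (fun n => ((Nat.primeCounting (Nat.sqrt n) : ℕ) : ℝ) ^ ((1 : ℝ) / 3))
      atTop atTop :=
    (tendsto_rpow_atTop (by norm_num)).comp (tendsto_natCast_atTop_atTop.comp hNt)
  filter_upwards [hsq.eventually_ge_atTop 2, hNt.eventually_ge_atTop (24 * ℓ),
    hNr.eventually_ge_atTop (6 / κ), eventually_ge_atTop 900] with n hs2 hN24 hNκ hn
  set N := Nat.primeCounting (Nat.sqrt n) with hNdef
  have hN1 : (1 : ℝ) ≤ N := by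
    have : 1 ≤ N := by omega
    exact_mod_cast this
  set y : ℝ := (N : ℝ) ^ ((1 : ℝ) / 3) with hy
  have hy1 : 1 ≤ y := Real.one_le_rpow hN1 (by norm_num)
  have hy3 : y ^ 3 = N := by
    rw [hy, ← Real.rpow_natCast, ← Real.rpow_mul (by positivity)]; norm_num
  set c := ⌈y ^ 2⌉₊ with hc
  have hc1 : y ^ 2 ≤ c := Nat.le_ceil _
  have hc2 : (c : ℝ) ≤ 2 * y ^ 2 := by
    have h1 := Nat.ceil_lt_add_one (a := y ^ 2) (by positivity)
    have h2 : 1 ≤ y ^ 2 := one_le_pow₀ hy1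
    linarith
  have hcpos : 1 ≤ c := by
    have : (0 : ℝ) < c := lt_of_lt_of_le (by positivity) hc1
    exact_mod_cast this
  have hq3 : N ^ 2 * 2 ^ (48 * ℓ) ≤ (2 ^ (16 * ℓ) * c) ^ 3 := by
    have h1 : N ^ 2 ≤ c ^ 3 := by
      have : (N : ℝ) ^ 2 ≤ (c : ℝ) ^ 3 := by
        calc (N : ℝ) ^ 2 = (y ^ 2) ^ 3 := by rw [← hy3]; ring
          _ ≤ _ := by gcongr
      exact_mod_cast this
    calc N ^ 2 * 2 ^ (48 * ℓ) ≤ c ^ 3 * 2 ^ (48 * ℓ) := Nat.mul_le_mul_right _ h1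
      _ = _ := by rw [mul_pow, ← pow_mul, mul_comm]; congr 2; ring
  obtain ⟨m, hm1, hm2⟩ := lower_comb ℓ n (2 ^ (16 * ℓ) * c) hℓ
    (Nat.mul_pos (by positivity) hcpos) hs2 hN24 (by
      calc N ^ (24 * ℓ) * 2 ^ ((24 * ℓ) * (24 * ℓ)) = (N ^ 2 * 2 ^ (48 * ℓ)) ^ (12 * ℓ) := by
            rw [mul_pow, ← pow_mul, ← pow_mul]; congr 2 <;> ring
        _ ≤ ((2 ^ (16 * ℓ) * c) ^ 3) ^ (12 * ℓ) := Nat.pow_le_pow_left hq3 _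
        _ = _ := by rw [← pow_mul]; congr 1; ring)
  rw [← hNdef] at hm1 hm2
  have hm1' : (N : ℝ) * N ≤ 2 * (K * c * (m + 1)) := by rw [hK]; exact_mod_cast hm1
  have hm2' : (Nat.primeCounting n : ℝ) + Nat.primeCounting (n / 2) + m
      ≤ Fkd (36 * ℓ) 3 n + 2 * N := by exact_mod_cast hm2
  -- m + 1 ≥ κ y^4
  have hmy : κ * y ^ 4 ≤ m + 1 := by
    have h1 : y ^ 6 ≤ 4 * K * y ^ 2 * (m + 1) := by
      calc y ^ 6 = (N : ℝ) * N := by rw [← hy3]; ring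
        _ ≤ 2 * (K * c * (m + 1)) := hm1'
        _ ≤ 2 * (K * (2 * y ^ 2) * (m + 1)) := by gcongr
        _ = _ := by ring
    have h2 : y ^ 4 ≤ 4 * K * (m + 1) := by
      have hy2 : 0 < y ^ 2 := by positivity
      refine le_of_mul_le_mul_left ?_ hy2
      calc y ^ 2 * y ^ 4 = y ^ 6 := by ring
        _ ≤ _ := h1
        _ = _ := by ring
    rw [hκ, one_div, inv_mul_le_iff₀ (by positivity)]
    exact h2
  have h3N : 3 * (N : ℝ) ≤ κ / 2 * y ^ 4 := by
    have h1 : 6 ≤ y * κ := (div_le_iff₀ hκpos).1 hNκ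
    rw [← hy3]
    have : 0 < y ^ 3 := by positivity
    nlinarith
  have hmain : κ / 2 * y ^ 4 ≤ m - 2 * N := by linarith
  -- compare with z
  have hn0 : (900 : ℝ) ≤ n := by exact_mod_cast hn
  have hsqrt : 30 ≤ Real.sqrt n := by
    apply Real.le_sqrt_of_sq_le; norm_num; linarith
  have hpi := pi_lower (Real.sqrt n) hsqrt
  rw [Real.nat_floor_real_sqrt_eq_nat_sqrt, ← hNdef, Real.log_sqrt (by positivity)] at hpi
  have hlogpos : 0 < Real.log n := Real.log_pos (by linarith)
  set z : ℝ := Real.sqrt n / Real.log n with hz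
  have hzN : 1 / 4 * z ≤ N := by
    refine le_trans ?_ hpi
    rw [hz, ← mul_div_assoc, div_le_div_iff₀ hlogpos (by positivity)]
    have : 0 < Real.sqrt n * Real.log n := by positivity
    nlinarith
  have hz1 : 1 ≤ z := by
    rw [hz, le_div_iff₀ hlogpos, one_mul]
    -- log n = 4 log (n^{1/4})
    set w := Real.sqrt (Real.sqrt n) with hw
    have hw2 : w ^ 2 = Real.sqrt n := Real.sq_sqrt (by positivity)
    have hw5 : 5 ≤ w := by apply Real.le_sqrt_of_sq_le; linarith
    have hl : Real.log n = 4 * Real.log w := by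
      rw [hw, Real.log_sqrt (by positivity), Real.log_sqrt (by positivity)]; ring
    have h1 : Real.log w ≤ w - 1 := Real.log_le_sub_one_of_pos (by linarith)
    rw [hl, ← hw2]
    nlinarith
  have hℓ' : (1 : ℝ) ≤ ℓ := by exact_mod_cast hℓ
  set e : ℝ := (9 * (ℓ : ℝ)) / (9 * (ℓ : ℝ) - 1) with he
  have he43 : e ≤ 4 / 3 := by
    rw [he, div_le_div_iff₀ (by linarith) (by norm_num)]; linarith
  have hexp : (9 * (ℓ : ℝ)) / (18 * (ℓ : ℝ) - 2) = 1 / 2 * e := by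
    rw [he]
    have h1 : 9 * (ℓ : ℝ) - 1 ≠ 0 := by linarith
    rw [show 18 * (ℓ : ℝ) - 2 = 2 * (9 * (ℓ : ℝ) - 1) by ring]
    field_simp
  have hze : (n : ℝ) ^ ((9 * (ℓ : ℝ)) / (18 * (ℓ : ℝ) - 2)) / (Real.log n) ^ e = z ^ e := by
    rw [hexp, Real.rpow_mul (by positivity), ← Real.sqrt_eq_rpow, hz,
      Real.div_rpow (by positivity) hlogpos.le]
  have hy4 : y ^ 4 = (N : ℝ) ^ ((4 : ℝ) / 3) := by
    rw [hy, ← Real.rpow_natCast, ← Real.rpow_mul (by positivity)]; norm_num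
  have hfin : κ / 2 * (1 / 4) ^ ((4 : ℝ) / 3) * z ^ e ≤ κ / 2 * y ^ 4 := by
    rw [hy4, mul_assoc]
    apply mul_le_mul_of_nonneg_left _ (by positivity)
    calc (1 / 4 : ℝ) ^ ((4 : ℝ) / 3) * z ^ e ≤ (1 / 4 : ℝ) ^ ((4 : ℝ) / 3) * z ^ ((4 : ℝ) / 3) := by
          gcongr
      _ = (1 / 4 * z) ^ ((4 : ℝ) / 3) := by
          rw [Real.mul_rpow (by norm_num) (by linarith)]
      _ ≤ _ := by gcongr
  rw [mul_div_assoc, hze]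
  linarith

theorem stmt_15 (ℓ : ℕ) (hℓ : 1 ≤ ℓ) :
    ∃ c1 c2 : ℝ, 0 < c1 ∧ 0 < c2 ∧ ∀ᶠ n : ℕ in Filter.atTop,
      (Nat.primeCounting n : ℝ) + (Nat.primeCounting (n / 2) : ℝ)
          + c1 * (n : ℝ) ^ ((9 * (ℓ : ℝ)) / (18 * (ℓ : ℝ) - 2))
              / (Real.log n) ^ ((9 * (ℓ : ℝ)) / (9 * (ℓ : ℝ) - 1))
        ≤ (Fkd (36 * ℓ) 3 n : ℝ) ∧
      (Fkd (36 * ℓ) 3 n : ℝ)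
        ≤ (Nat.primeCounting n : ℝ) + (Nat.primeCounting (n / 2) : ℝ)
            + c2 * (n : ℝ) ^ ((5 : ℝ)/6) := by
  obtain ⟨c1, hc1, h1⟩ := lower_bound ℓ hℓ
  refine ⟨c1, 9221 + 36 * ℓ, hc1, by positivity, ?_⟩
  filter_upwards [h1, eventually_ge_atTop 1] with n hn1 hn
  exact ⟨hn1, upper_bound ℓ n hℓ hn⟩
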